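/- If a clause C is not semantically blocked in a formula F, then there exists a formula F' with env_{F'}(C) = env_F(C) such that C is not redundant with respect to F' (i.e., F' \ {C} is satisfiable but F' ∪ {C} is unsatisfiable). -/

import Mathlib

abbrev Var := ℕ
abbrev Lit := Var × Bool
abbrev Clause := Finset Lit
abbrev Formula := Set Clause

def Lit.compl (l : Lit) : Lit := (l.1, !l.2)

def Clause.isTaut (C : Clause) : Prop := ∃ l ∈ C, Lit.compl l ∈ C

abbrev Assign := Var → Bool

def litSat (τ : Assign) (l : Lit) : Prop := τ l.1 = l.2
def clauseSat (τ : Assign) (C : Clause) : Prop := ∃ l ∈ C, litSat τ l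
def formulaSat (τ : Assign) (F : Formula) : Prop := ∀ C ∈ F, clauseSat τ C
def satisfiable (F : Formula) : Prop := ∃ τ : Assign, formulaSat τ F
def satEquiv (F G : Formula) : Prop := satisfiable F ↔ satisfiable G
def redundant (F : Formula) (C : Clause) : Prop := satEquiv (F \ {C}) (F ∪ {C})

def env (F : Formula) (C : Clause) : Formula := {D ∈ F | ∃ l ∈ D, Lit.compl l ∈ C}
def clauseVars (C : Clause) : Set Var := {v | ∃ l ∈ C, l.1 = v}
def formulaVars (F : Formula) : Set Var := {v | ∃ D ∈ F, ∃ l ∈ D, l.1 = v}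
def extVars (F : Formula) (C : Clause) : Set Var := formulaVars (env F C) \ clauseVars C

def semBlocked (F : Formula) (C : Clause) : Prop :=
  ∀ τ : Assign, formulaSat τ (env F C) →
    ∃ τ' : Assign, formulaSat τ' (env F C ∪ {C}) ∧ ∀ v : Var, v ∉ clauseVars C → τ v = τ' v

def blocksLit (F : Formula) (C : Clause) (l : Lit) : Prop :=
  l ∈ C ∧ ∀ D ∈ F, Lit.compl l ∈ D → Clause.isTaut (C ∪ D.erase (Lit.compl l))
def litBlocked (F : Formula) (C : Clause) : Prop := ∃ l : Lit, blocksLit F C l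

def complSet (L : Finset Lit) : Finset Lit := L.image Lit.compl
def blocksSet (F : Formula) (C : Clause) (L : Finset Lit) : Prop :=
  L.Nonempty ∧ L ⊆ C ∧
    ∀ D ∈ F, (D ∩ complSet L).Nonempty → Clause.isTaut ((C \ L) ∪ complSet L ∪ D)
def setBlocked (F : Formula) (C : Clause) : Prop := ∃ L : Finset Lit, blocksSet F C L

abbrev PAssign := Var → Option Bool
def pdom (σ : PAssign) : Set Var := {v | σ v ≠ none}
def plitSat (σ : PAssign) (l : Lit) : Prop := σ l.1 = some l.2
def pclauseSat (σ : PAssign) (C : Clause) : Prop := ∃ l ∈ C, plitSat σ l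
def pformulaSat (σ : PAssign) (F : Formula) : Prop := ∀ C ∈ F, pclauseSat σ C
def restrictF (F : Formula) (σ : PAssign) : Formula := {D ∈ F | ¬ pclauseSat σ D}
def punion (σ₁ σ₂ : PAssign) : PAssign := fun v => (σ₁ v).orElse (fun _ => σ₂ v)

def superBlocked (F : Formula) (C : Clause) : Prop :=
  ∀ σ : PAssign, pdom σ = extVars F C → setBlocked (restrictF F σ) C

def litClauses (F : Formula) (l : Lit) : Formula := {D ∈ F | l ∈ D}
def resolvents (F : Formula) (x : Var) : Formula :=
  {R | ∃ C ∈ litClauses F (x, true), ∃ D ∈ litClauses F (x, false),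
    R = C.erase (x, true) ∪ D.erase (x, false) ∧ ¬ Clause.isTaut R}
def elimVar (F : Formula) (x : Var) : Formula :=
  (F \ (litClauses F (x, true) ∪ litClauses F (x, false))) ∪ resolvents F x

def asymLit (F : Formula) (C : Clause) (l : Lit) : Prop :=
  ∃ D : Clause, D ⊆ C ∧ insert (Lit.compl l) D ∈ F \ {C}
def asymTaut (F : Formula) (C : Clause) : Prop :=
  ∃ ls : List Lit, Clause.isTaut (C ∪ ls.toFinset) ∧
    ∀ i : Fin ls.length, asymLit F (C ∪ (ls.take i.val).toFinset) (ls.get i)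
def ratPair (F : Formula) (C : Clause) : Prop :=
  asymTaut F C ∨
    ∃ l ∈ C, ∀ D ∈ F, Lit.compl l ∈ D → asymTaut F (C ∪ D.erase (Lit.compl l))

theorem not_semBlocked_not_locally_redundant (F : Formula) (C : Clause)
    (h : ¬ semBlocked F C) :
    ∃ F' : Formula, env F' C = env F C ∧
      satisfiable (F' \ {C}) ∧ ¬ satisfiable (F' ∪ {C}) := by
  simp only [semBlocked, not_forall] at h
  obtain ⟨τ, hτ, hno⟩ := h
  refine ⟨env F C ∪ {D | ∃ v, v ∉ clauseVars C ∧ D = {(v, τ v)}}, ?_, ⟨τ, ?_⟩, ?_⟩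
  · ext D
    constructor
    · rintro ⟨hD | ⟨v, hv, rfl⟩, l, hl, hlC⟩
      · exact hD
      · rw [Finset.mem_singleton] at hl
        subst hl
        exact absurd ⟨_, hlC, rfl⟩ hv
    · exact fun hD => ⟨Or.inl hD, hD.2⟩
  · rintro D ⟨hD | ⟨v, -, rfl⟩, -⟩
    · exact hτ D hD
    · exact ⟨_, Finset.mem_singleton_self _, rfl⟩
  · rintro ⟨τ', hτ'⟩
    refine hno ⟨τ', ?_, fun v hv => ?_⟩
    · rintro D (hD | hD)
      · exact hτ' D (Or.inl (Or.inl hD))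
      · exact hτ' D (Or.inr hD)
    · obtain ⟨l, hl, hsat⟩ := hτ' {(v, τ v)} (Or.inl (Or.inr ⟨v, hv, rfl⟩))
      rw [Finset.mem_singleton] at hl
      subst hl
      exact hsat.symm
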